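/- arXiv:1103.5619 — 2 statements merged into one kernel-verified Lean document; each statement's English description precedes it below -/
import Mathlib

section
/- With the signed-permutation setup (G ≤ W_g containing δ, acting transitively on {1,…,g}×{+1,−1}, with stabilizer H of (1,+1), positive set S, and primitivity condition that every τ ∈ G with Sτ = S lies in H), and with U ≤ ℤ^g the subgroup generated by the indicator vectors 1_{T(σ)} for σ ∈ G: if g = 4, then either the quotient group ℤ⁴/U is torsion-free, or U = {(a,b,c,d) ∈ ℤ⁴ : a+b+c+d ≡ 0 (mod 2)}. -/
/-- The signed permutation `δ`, sending `(i, ε)` to `(i, −ε)` (complex conjugation). -/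
def signFlip (g : ℕ) : Equiv.Perm (Fin g × Bool) :=
  Equiv.prodCongr (Equiv.refl (Fin g))
    ⟨fun b => !b, fun b => !b, fun b => Bool.not_not b, fun b => Bool.not_not b⟩

/-- The subgroup `U ≤ ℤ^g` generated by the indicator vectors `1_{T(σ)}`, `σ ∈ G`, where
`T(σ) = {i : σ(j,+1) = (i,−1) for some j}`. -/
def imageLattice (g : ℕ) (G : Subgroup (Equiv.Perm (Fin g × Bool))) :
    AddSubgroup (Fin g → ℤ) :=
  AddSubgroup.closure
    {v | ∃ σ ∈ G, v = fun i => if ∃ j, σ (j, true) = (i, false) then 1 else 0}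

theorem isAddTorsionFree_quotient_of_mem_iff {A : Type*} [AddCommGroup A] (U : AddSubgroup A)
    (φ : A →+ ℤ) (h : ∀ v, v ∈ U ↔ φ v = 0) : IsAddTorsionFree (A ⧸ U) := by
  obtain rfl : U = φ.ker := by ext v; rw [h, AddMonoidHom.mem_ker]
  exact (QuotientAddGroup.kerLift_injective φ).isAddTorsionFree (QuotientAddGroup.kerLift φ)

/-- A subgroup of `ℤ⁴` containing `(1,1,1,1)` and generated by a set of 0-1 vectors that separates
the coordinates either has torsion-free quotient or consists of the vectors with even sum. -/
theorem isAddTorsionFree_quotient_or_even_of_separating (X : Set (Fin 4 → ℤ))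
    (h01 : ∀ v ∈ X, ∀ i, v i = 0 ∨ v i = 1) (hone : ![1, 1, 1, 1] ∈ X)
    (hsep : ∀ i j, i ≠ j → ∃ v ∈ X, v i ≠ v j) :
    IsAddTorsionFree ((Fin 4 → ℤ) ⧸ AddSubgroup.closure X) ∨
      (∀ v : Fin 4 → ℤ, v ∈ AddSubgroup.closure X ↔ (2 : ℤ) ∣ ∑ i, v i) := by
  set U := AddSubgroup.closure X
  have hX : ∀ v ∈ X, v ∈ U := fun v hv => AddSubgroup.subset_closure hv
  obtain ⟨e, he⟩ : ∃ e : Fin 4 → Fin 4 → ℤ, e = fun i => Pi.single i 1 := ⟨_, rfl⟩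
  have comb : ∀ (a b w : Fin 4 → ℤ) (m n : ℤ), a ∈ U → b ∈ U → m • a + n • b = w → w ∈ U := by
    rintro a b w m n ha hb rfl
    exact U.add_mem (U.zsmul_mem ha m) (U.zsmul_mem hb n)
  have hdecomp : ∀ (v : Fin 4 → ℤ) (i j k l : Fin 4), [i, j, k, l].Nodup →
      v = v i • e i + v j • e j + v k • e k + v l • e l := by
    intro v i j k l h
    ext t
    have ht : ∀ i j k l t : Fin 4, [i, j, k, l].Nodup → t = i ∨ t = j ∨ t = k ∨ t = l := by
      decide
    simp only [List.nodup_cons, List.mem_cons, List.not_mem_nil, or_false, not_or] at h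
    rcases ht i j k l t (by simp [h]) with rfl | rfl | rfl | rfl <;>
      simp [he, h]
  have hone' : ∀ i j k l : Fin 4, [i, j, k, l].Nodup → e i + e j + e k + e l ∈ U := by
    intro i j k l h
    have := hdecomp ![1, 1, 1, 1] i j k l h
    have hc : ∀ t : Fin 4, (![1, 1, 1, 1] : Fin 4 → ℤ) t = 1 := by decide
    simp only [hc, one_smul] at this
    exact this ▸ hX _ hone
  have hQE : ∀ i j, e i + e j ∈ U → e i ∈ U → e j ∈ U := fun i j hq hi =>
    comb _ _ _ 1 (-1) hq hi (by module)
  have hQs : ∀ i j, e i + e j ∈ U → e j + e i ∈ U := fun i j h => by rwa [add_comm]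
  have hQc : ∀ i j k l, [i, j, k, l].Nodup → e i + e j ∈ U → e k + e l ∈ U :=
    fun i j k l h hq => comb _ _ _ 1 (-1) (hone' i j k l h) hq (by module)
  have hEc : ∀ i j k l, [i, j, k, l].Nodup → e i + e j + e k ∈ U → e l ∈ U :=
    fun i j k l h hq => comb _ _ _ 1 (-1) (hone' i j k l h) hq (by module)
  have hsplit : ∀ i j k l, [i, j, k, l].Nodup →
      e i ∈ U ∨ e j ∈ U ∨ e i + e k ∈ U ∨ e i + e l ∈ U := by
    intro i j k l h
    have hij : i ≠ j := by rintro rfl; simp at h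
    obtain ⟨v, hv, hne⟩ := hsep i j hij
    have hvU := hX v hv
    rw [hdecomp v i j k l h] at hvU
    obtain ⟨p1, p2, p3, p4⟩ : [i, k, l, j].Nodup ∧ [j, k, l, i].Nodup ∧ [j, k, i, l].Nodup ∧
        [j, l, i, k].Nodup := by
      clear * - h; decide +revert
    rcases h01 v hv i with hi | hi <;> rcases h01 v hv j with hj | hj <;>
      rcases h01 v hv k with hk | hk <;> rcases h01 v hv l with hl | hl <;>
      simp only [hi, hj, hk, hl, zero_smul, one_smul, zero_add, add_zero, ne_eq,
        not_true_eq_false] at hvU hne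
    all_goals grind
  have hbal : (∀ i, e i ∉ U) → ∀ v ∈ X, ∀ i j k l, [i, j, k, l].Nodup →
      2 ∣ v i + v j + v k + v l ∧ (v i + v l = v j + v k ∨ e i + e l ∈ U) := by
    intro hno v hv i j k l h
    have hvU := hX v hv
    rw [hdecomp v i j k l h] at hvU
    obtain ⟨p1, p2, p3, p4⟩ : [i, j, l, k].Nodup ∧ [i, k, l, j].Nodup ∧ [j, k, l, i].Nodup ∧
        [j, k, i, l].Nodup := by
      clear * - h; decide +revert
    rcases h01 v hv i with hi | hi <;> rcases h01 v hv j with hj | hj <;>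
      rcases h01 v hv k with hk | hk <;> rcases h01 v hv l with hl | hl <;>
      simp only [hi, hj, hk, hl, zero_smul, one_smul, zero_add, add_zero] at hvU ⊢
    all_goals grind
  by_cases hE : ∃ i, e i ∈ U
  · obtain ⟨i, hi⟩ := hE
    have two : ∀ i j k l, [i, j, k, l].Nodup → e i ∈ U → e j ∈ U → U = ⊤ := by
      intro i j k l h hi hj
      have hkl : e k ∈ U ∧ e l ∈ U := by
        have h' : [k, l, i, j].Nodup := by clear * - h; decide +revert
        have := hQc i j k l h (U.add_mem hi hj)
        have := hsplit k l i j h'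
        grind
      refine (AddSubgroup.eq_top_iff' U).2 fun v => ?_
      rw [hdecomp v i j k l h]
      exact comb _ _ _ 1 1 (comb _ _ _ (v i) (v j) hi hj rfl)
        (comb _ _ _ (v k) (v l) hkl.1 hkl.2 rfl) (by module)
    obtain ⟨j, k, l, h⟩ : ∃ j k l, [i, j, k, l].Nodup := by
      clear hi; decide +revert
    obtain ⟨p1, p2, p3⟩ : [j, k, i, l].Nodup ∧ [i, k, j, l].Nodup ∧ [j, l, i, k].Nodup := by
      clear * - h; decide +revert
    have htop : U = ⊤ := by
      rcases hsplit j k i l p1 with hj | hk | hq | hq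
      · exact two i j k l h hi hj
      · exact two i k j l p2 hi hk
      · exact two i j k l h hi (hQE i j (hQs _ _ hq) hi)
      · exact two i k j l p2 hi (hQE i k (hQc j l i k p3 hq) hi)
    exact .inl (isAddTorsionFree_quotient_of_mem_iff U 0 (by simp [htop]))
  push Not at hE
  by_cases hQ : ∃ i j k l, [i, j, k, l].Nodup ∧ e i + e l ∉ U
  · obtain ⟨i, j, k, l, h, hil⟩ := hQ
    have h' : [i, k, j, l].Nodup := by clear * - h; decide +revert
    have hij : e i + e j ∈ U :=
      (((hsplit i k j l h').resolve_left (hE i)).resolve_left (hE k)).resolve_right hil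
    have hik : e i + e k ∈ U :=
      (((hsplit i j k l h).resolve_left (hE i)).resolve_left (hE j)).resolve_right hil
    have hkl : e k + e l ∈ U := hQc i j k l h hij
    left
    let ev := Pi.evalAddMonoidHom (fun _ : Fin 4 => ℤ)
    refine isAddTorsionFree_quotient_of_mem_iff U (ev i + ev l - ev j - ev k) fun v => ?_
    have hev : (ev i + ev l - ev j - ev k) v = v i + v l - v j - v k := rfl
    constructor
    · intro hv
      have : U ≤ (ev i + ev l - ev j - ev k).ker := by
        refine (AddSubgroup.closure_le _).2 fun w hw => ?_
        have := ((hbal hE w hw i j k l h).2).resolve_right hil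
        change w i + w l - w j - w k = 0
        linarith
      exact this hv
    · intro hv
      rw [hev] at hv
      have hk : v k = v i + v l - v j := by linarith
      rw [hdecomp v i j k l h, hk]
      exact comb _ _ _ 1 (v l) (comb _ _ _ (v j) (v i - v j) hij hik rfl) hkl (by module)
  · push Not at hQ
    right
    intro v
    constructor
    · intro hv
      induction hv using AddSubgroup.closure_induction with
      | mem w hw =>
        rw [Fin.sum_univ_four]
        exact (hbal hE w hw 0 1 2 3 (by decide)).1
      | zero => simp
      | add x y _ _ hx hy =>
        simp only [Pi.add_apply, Finset.sum_add_distrib]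
        exact dvd_add hx hy
      | neg x _ hx =>
        simp only [Pi.neg_apply, Finset.sum_neg_distrib]
        exact (dvd_neg).2 hx
    · rintro ⟨c, hc⟩
      rw [Fin.sum_univ_four] at hc
      have h01' : e 0 + e 1 ∈ U := hQ 0 2 3 1 (by decide)
      have h02 : e 0 + e 2 ∈ U := hQ 0 1 3 2 (by decide)
      have h03 : e 0 + e 3 ∈ U := hQ 0 1 2 3 (by decide)
      have h12 : e 1 + e 2 ∈ U := hQ 1 0 3 2 (by decide)
      have h0 : v 0 = 2 * c - v 1 - v 2 - v 3 := by linarith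
      rw [hdecomp v 0 1 2 3 (by decide), h0]
      have hd : (2 : ℤ) • e 0 ∈ U :=
        comb _ _ _ 1 (-1) (comb _ _ _ 1 1 h01' h02 rfl) h12 (by module)
      exact comb _ _ _ 1 1 (comb _ _ _ (v 1) (v 2) h01' h02 rfl)
        (comb _ _ _ (v 3) (c - v 1 - v 2 - v 3) h03 hd rfl) (by module)

/-- The dichotomy in the proof of Lemma 7.11: in the signed-permutation setup with
`g = 4`, either `ℤ⁴/U` is torsion-free, or `U` is the sublattice of vectors with even
coordinate sum. -/
theorem imageLattice_four_dichotomy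
    (G : Subgroup (Equiv.Perm (Fin 4 × Bool)))
    (hsigned : ∀ σ ∈ G, ∀ p : Fin 4 × Bool, σ (p.1, !p.2) = ((σ p).1, !(σ p).2))
    (hδ : signFlip 4 ∈ G)
    (htrans : ∀ p q : Fin 4 × Bool, ∃ σ ∈ G, σ p = q)
    (hprim : ∀ τ ∈ G,
      (fun σ => σ * τ) '' {σ | σ ∈ G ∧ (σ ((0 : Fin 4), true)).2 = true}
          = {σ | σ ∈ G ∧ (σ ((0 : Fin 4), true)).2 = true} →
      τ ((0 : Fin 4), true) = ((0 : Fin 4), true)) :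
    IsAddTorsionFree ((Fin 4 → ℤ) ⧸ imageLattice 4 G) ∨
      (∀ v : Fin 4 → ℤ, v ∈ imageLattice 4 G ↔ (2 : ℤ) ∣ ∑ i, v i) := by
  have hinv : ∀ σ ∈ G, ∀ i : Fin 4,
      (∃ j, σ (j, true) = (i, false)) ↔ (σ⁻¹ (i, true)).2 = false := by
    intro σ hσ i
    have hs := hsigned σ⁻¹ (G.inv_mem hσ) (i, true)
    simp only [Bool.not_true] at hs
    constructor
    · rintro ⟨j, hj⟩
      rw [← hj, Equiv.Perm.inv_def, Equiv.symm_apply_apply, ← Equiv.Perm.inv_def] at hs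
      simpa using (congrArg Prod.snd hs).symm
    · intro h
      refine ⟨(σ⁻¹ (i, true)).1, ?_⟩
      rw [h, Bool.not_false] at hs
      rw [← hs, Equiv.Perm.inv_def, Equiv.apply_symm_apply]
  refine isAddTorsionFree_quotient_or_even_of_separating _ ?_ ?_ ?_
  · rintro v ⟨σ, -, rfl⟩ i
    dsimp only
    split_ifs <;> simp
  · refine ⟨signFlip 4, hδ, ?_⟩
    ext i
    rw [if_pos ⟨i, rfl⟩]
    fin_cases i <;> rfl
  · intro i j hij
    by_contra! hcon
    apply hij
    have hsame : ∀ σ ∈ G, (σ (i, true)).2 = (σ (j, true)).2 := by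
      intro σ hσ
      have hv := hcon _ ⟨σ⁻¹, G.inv_mem hσ, rfl⟩
      simp only [hinv _ (G.inv_mem hσ), inv_inv] at hv
      cases hi : (σ (i, true)).2 <;> cases hj : (σ (j, true)).2 <;> simp [hi, hj] at hv ⊢
    obtain ⟨ρ, hρ, hρi⟩ := htrans (0, true) (i, true)
    obtain ⟨ρ', hρ', hρj⟩ := htrans (0, true) (j, true)
    have hpos : ∀ σ ∈ G, (σ (ρ (0, true))).2 = (σ (ρ' (0, true))).2 := by
      intro σ hσ
      rw [hρi, hρj, hsame σ hσ]
    have hτ := hprim (ρ⁻¹ * ρ') (G.mul_mem (G.inv_mem hρ) hρ') <| by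
      ext σ
      constructor
      · rintro ⟨σ, ⟨hσ, hs⟩, rfl⟩
        refine ⟨G.mul_mem hσ (G.mul_mem (G.inv_mem hρ) hρ'), ?_⟩
        have h := hpos (σ * ρ⁻¹) (G.mul_mem hσ (G.inv_mem hρ))
        rw [← Equiv.Perm.mul_apply, ← Equiv.Perm.mul_apply, inv_mul_cancel_right, mul_assoc] at h
        exact h.symm.trans hs
      · rintro ⟨hσ, hs⟩
        refine ⟨σ * ρ'⁻¹ * ρ, ⟨G.mul_mem (G.mul_mem hσ (G.inv_mem hρ')) hρ, ?_⟩, by group⟩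
        have h := hpos (σ * ρ'⁻¹) (G.mul_mem hσ (G.inv_mem hρ'))
        rw [← Equiv.Perm.mul_apply, ← Equiv.Perm.mul_apply, inv_mul_cancel_right] at h
        exact h.trans hs
    rw [Equiv.Perm.mul_apply, hρj, Equiv.Perm.inv_eq_iff_eq, hρi] at hτ
    exact (congrArg Prod.fst hτ).symm
end

section
/- With the signed-permutation setup (G ≤ W_g containing δ, acting transitively on {1,…,g}×{+1,−1}, with stabilizer H of (1,+1), positive set S, and primitivity condition that every τ ∈ G with Sτ = S lies in H), and with U ≤ ℤ^g the subgroup generated by the indicator vectors 1_{T(σ)} for σ ∈ G: if g = 5, then the quotient group ℤ⁵/U is either torsion-free or isomorphic to ℤ/3ℤ. -/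
/-- Pulling functions back along `e.symm`, as an additive homomorphism. -/
def reindexHom {α β : Type*} (e : α ≃ β) : (α → ℤ) →+ (β → ℤ) where
  toFun f := f ∘ e.symm
  map_zero' := rfl
  map_add' _ _ := rfl

/-- `U` contains `3 e_a` and all the `e_a + e_j` with `j ≠ a`. -/
def ContainsStar {α : Type*} [DecidableEq α] (U : AddSubgroup (α → ℤ)) (a : α) : Prop :=
  (3 : ℤ) • Pi.single a (1 : ℤ) ∈ U ∧
    ∀ j, j ≠ a → Pi.single a (1 : ℤ) + Pi.single j (1 : ℤ) ∈ U

theorem reindexHom_single {α β : Type*} [DecidableEq α] [DecidableEq β] (e : α ≃ β) (a : α)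
    (n : ℤ) : reindexHom e (Pi.single a n) = Pi.single (e a) n := by
  ext x
  simp [reindexHom, Pi.single_apply, Equiv.symm_apply_eq]

theorem ContainsStar.of_comap {α β : Type*} [DecidableEq α] [DecidableEq β] (e : α ≃ β)
    {U : AddSubgroup (β → ℤ)} {a : α} (h : ContainsStar (U.comap (reindexHom e)) a) :
    ContainsStar U (e a) := by
  obtain ⟨h3, hj⟩ := h
  refine ⟨by simpa only [AddSubgroup.mem_comap, map_zsmul, reindexHom_single] using h3,
    fun j hja => ?_⟩
  have := hj (e.symm j) (by rwa [Ne, Equiv.symm_apply_eq])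
  simpa only [AddSubgroup.mem_comap, map_add, reindexHom_single, Equiv.apply_symm_apply] using this

theorem containsStar_of_single_mem {α : Type*} [DecidableEq α] {U : AddSubgroup (α → ℤ)} (a : α)
    (h : ∀ j, Pi.single j (1 : ℤ) ∈ U) : ContainsStar U a :=
  ⟨U.zsmul_mem (h a) 3, fun j _ => U.add_mem (h a) (h j)⟩

theorem ContainsStar.sub_smul_single_mem {α : Type*} [Fintype α] [DecidableEq α]
    {U : AddSubgroup (α → ℤ)} {a : α} (h : ContainsStar U a) (x : α → ℤ) :
    x - (2 * x a - ∑ j, x j) • Pi.single a (1 : ℤ) ∈ U := by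
  have key : x - (2 * x a - ∑ j, x j) • Pi.single a (1 : ℤ) =
      ∑ j ∈ Finset.univ.erase a, x j • (Pi.single a (1 : ℤ) + Pi.single j (1 : ℤ)) := by
    rw [← Finset.add_sum_erase _ x (Finset.mem_univ a)]
    have hx : x = x a • Pi.single a (1 : ℤ) +
        ∑ j ∈ Finset.univ.erase a, x j • (Pi.single j (1 : ℤ) : α → ℤ) := by
      rw [Finset.add_sum_erase _ (fun j => x j • Pi.single j (1 : ℤ)) (Finset.mem_univ a)]
      simpa [← Pi.single_smul] using (Finset.univ_sum_single x).symm
    simp only [smul_add, Finset.sum_add_distrib, ← Finset.sum_smul]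
    nth_rewrite 1 [hx]
    module
  rw [key]
  exact U.sum_mem fun j hj => U.zsmul_mem (h.2 j (Finset.ne_of_mem_erase hj)) _

theorem ContainsStar.quotient {α : Type*} [Fintype α] [DecidableEq α]
    {U : AddSubgroup (α → ℤ)} {a : α} (h : ContainsStar U a) :
    IsAddTorsionFree ((α → ℤ) ⧸ U) ∨ Nonempty (((α → ℤ) ⧸ U) ≃+ ZMod 3) := by
  by_cases ha : Pi.single a (1 : ℤ) ∈ U
  · left
    have htop : U = ⊤ := by
      rw [eq_top_iff]
      intro x _
      have := U.add_mem (h.sub_smul_single_mem x) (U.zsmul_mem ha (2 * x a - ∑ j, x j))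
      simpa using this
    subst htop
    have : Subsingleton ((α → ℤ) ⧸ (⊤ : AddSubgroup (α → ℤ))) :=
      QuotientAddGroup.subsingleton_quotient_top
    exact ⟨fun n _ x y _ => Subsingleton.elim x y⟩
  · right
    let f : (α → ℤ) →+ ℤ :=
      { toFun := fun x => 2 * x a - ∑ j, x j
        map_zero' := by simp
        map_add' := fun x y => by simp only [Pi.add_apply, Finset.sum_add_distrib]; ring }
    let φ : (α → ℤ) →+ ZMod 3 := (Int.castAddHom (ZMod 3)).comp f
    have hf : f (Pi.single a 1) = 1 := by simp [f]
    have hφ : Function.Surjective φ := fun z => by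
      obtain ⟨n, rfl⟩ := ZMod.intCast_surjective z
      exact ⟨n • Pi.single a 1, by
        rw [AddMonoidHom.comp_apply, map_zsmul, hf]; simp⟩
    have hmem : ∀ x, x ∈ U ↔ f x • Pi.single a (1 : ℤ) ∈ U := fun x => by
      have hx := h.sub_smul_single_mem x
      constructor
      · intro hxU
        have := U.sub_mem hxU hx
        rwa [sub_sub_cancel] at this
      · intro hxU
        have := U.add_mem hx hxU
        rwa [show (2 * x a - ∑ j, x j) = f x from rfl, sub_add_cancel] at this
    have hker : U = φ.ker := by
      ext x
      rw [hmem, AddMonoidHom.mem_ker]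
      change _ ↔ ((f x : ℤ) : ZMod 3) = 0
      rw [ZMod.intCast_zmod_eq_zero_iff_dvd]
      constructor
      · intro hx
        by_contra hd
        refine ha ?_
        have h3 := h.1
        have : (Pi.single a (1 : ℤ) : α → ℤ) =
            (f x % 3) • (f x • Pi.single a (1 : ℤ)) -
              ((f x % 3 * f x - 1) / 3) • ((3 : ℤ) • Pi.single a (1 : ℤ)) := by
          have h1 : (f x % 3 * f x - 1) / 3 * 3 = f x % 3 * f x - 1 := by
            refine Int.ediv_mul_cancel ?_
            rcases (by omega : f x % 3 = 1 ∨ f x % 3 = 2) with h1 | h1 <;> rw [h1] <;> omega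
          rw [smul_smul, smul_smul, h1, ← sub_smul]
          simp
        rw [this]
        exact U.sub_mem (U.zsmul_mem hx _) (U.zsmul_mem h3 _)
      · rintro ⟨n, hn⟩
        push_cast at hn
        rw [hn, mul_comm, mul_smul]
        exact U.zsmul_mem h.1 n
    rw [hker]
    exact ⟨QuotientAddGroup.quotientKerEquivOfSurjective φ hφ⟩

/-- The affine permutation `j ↦ m j + s` of `ZMod 5`. -/
def affinePerm (m : (ZMod 5)ˣ) (s : ZMod 5) : ZMod 5 ≃ ZMod 5 :=
  (Units.mulLeft m).trans (Equiv.addRight s)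

theorem affinePerm_apply (m : (ZMod 5)ˣ) (s j : ZMod 5) : affinePerm m s j = m * j + s := rfl

theorem affinePerm_add (m : (ZMod 5)ˣ) (s j k : ZMod 5) :
    affinePerm m s (j + k) = affinePerm m s j + m * k := by
  simp only [affinePerm_apply]
  ring

/-- Up to affine substitutions and complement, a nonconstant Boolean function on `ZMod 5` is the
indicator function of `{0}` or of `{0, 1}`. -/
theorem exists_affinePerm_eq (t : ZMod 5 → Bool) (ht : ∃ i j, t i ≠ t j) :
    ∃ (m : (ZMod 5)ˣ) (s : ZMod 5) (b : Bool),
      (∀ j, t (affinePerm m s j) = (b ^^ decide (j = 0))) ∨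
      (∀ j, t (affinePerm m s j) = (b ^^ decide (j = 0 ∨ j = 1))) := by
  have key : ∀ t : ZMod 5 → Bool, (∃ i j, t i ≠ t j) →
      ∃ (m s : ZMod 5) (b : Bool), m * m ^ 3 = 1 ∧
      ((∀ j, t (m * j + s) = (b ^^ decide (j = 0))) ∨
      (∀ j, t (m * j + s) = (b ^^ decide (j = 0 ∨ j = 1)))) := by
    decide +kernel
  obtain ⟨m, s, b, hm, h⟩ := key t ht
  exact ⟨⟨m, m ^ 3, hm, by rw [mul_comm, hm]⟩, s, b, h⟩

theorem single_mem_of_all {V : AddSubgroup (ZMod 5 → ℤ)}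
    (h0 : Pi.single 0 (1 : ℤ) ∈ V) (h1 : Pi.single 1 (1 : ℤ) ∈ V) (h2 : Pi.single 2 (1 : ℤ) ∈ V)
    (h3 : Pi.single 3 (1 : ℤ) ∈ V) (h4 : Pi.single 4 (1 : ℤ) ∈ V) (j : ZMod 5) :
    Pi.single j (1 : ℤ) ∈ V := by
  fin_cases j <;> assumption

theorem exists_containsStar_of_coboundary {V : AddSubgroup (ZMod 5 → ℤ)} (hone : 1 ∈ V)
    (t : ZMod 5 → Bool) (ht : ∃ i j, t i ≠ t j)
    (hV : ∀ k, (fun j => if t j = t (j + k) then 0 else 1) ∈ V) : ∃ a, ContainsStar V a := by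
  obtain ⟨m, s, b, h⟩ := exists_affinePerm_eq t ht
  set e := affinePerm m s with he
  set W := V.comap (reindexHom e)
  suffices ∃ a, ContainsStar W a from this.imp' e fun a => ContainsStar.of_comap e
  have hone' : 1 ∈ W := hone
  have hW' : ∀ k, (fun j => if t (e j) = t (e (j + k)) then (0 : ℤ) else 1) ∈ W := fun k => by
    refine (congrArg (· ∈ V) ?_).mp (hV (m * k))
    ext x
    simp [reindexHom, he, affinePerm_add]
  clear_value W
  rcases h with h | h <;> simp only [h] at hW'
  · refine ⟨0, ?_, fun k hk => ?_⟩
    · have := W.sub_mem (W.add_mem (W.add_mem (hW' 1) (hW' 2)) (W.add_mem (hW' 3) (hW' 4))) hone'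
      refine (congrArg (· ∈ W) ?_).mp this
      ext x
      cases b <;> revert x <;> decide
    · refine (congrArg (· ∈ W) ?_).mp (hW' (-k))
      ext x
      cases b <;> revert x k <;> decide
  · have h2 : Pi.single 2 (1 : ℤ) ∈ W := by
      refine (congrArg (· ∈ W) ?_).mp (W.sub_mem hone' (hW' 2))
      ext x
      cases b <;> revert x <;> decide
    have h4 : Pi.single 4 (1 : ℤ) ∈ W := by
      refine (congrArg (· ∈ W) ?_).mp (W.sub_mem hone' (hW' 3))
      ext x
      cases b <;> revert x <;> decide
    have h1 : Pi.single 1 (1 : ℤ) ∈ W := by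
      refine (congrArg (· ∈ W) ?_).mp (W.sub_mem (hW' 1) h4)
      ext x
      cases b <;> revert x <;> decide
    have h0 : Pi.single 0 (1 : ℤ) ∈ W := by
      refine (congrArg (· ∈ W) ?_).mp (W.sub_mem (hW' 4) h2)
      ext x
      cases b <;> revert x <;> decide
    have h3 : Pi.single 3 (1 : ℤ) ∈ W := by
      refine (congrArg (· ∈ W) ?_).mp
        (W.sub_mem hone' (W.add_mem (W.add_mem h0 h1) (W.add_mem h2 h4)))
      ext x
      revert x
      decide
    exact ⟨0, containsStar_of_single_mem 0 (single_mem_of_all h0 h1 h2 h3 h4)⟩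

theorem exists_containsStar_of_translates {V : AddSubgroup (ZMod 5 → ℤ)} (hone : 1 ∈ V)
    (t : ZMod 5 → Bool) (ht : ∃ i j, t i ≠ t j)
    (hV : ∀ k, (fun j => if t (j + k) then 0 else 1) ∈ V) : ∃ a, ContainsStar V a := by
  obtain ⟨m, s, b, h⟩ := exists_affinePerm_eq t ht
  set e := affinePerm m s with he
  set W := V.comap (reindexHom e)
  suffices ∃ a, ContainsStar W a from this.imp' e fun a => ContainsStar.of_comap e
  have hone' : 1 ∈ W := hone
  have hW' : ∀ k, (fun j => if (t (e (j + k)) ^^ b) then (1 : ℤ) else 0) ∈ W := fun k => by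
    have hk : (fun j => if t (e (j + k)) then (0 : ℤ) else 1) ∈ W := by
      refine (congrArg (· ∈ V) ?_).mp (hV (m * k))
      ext x
      simp [reindexHom, he, affinePerm_add]
    cases b
    · refine (congrArg (· ∈ W) ?_).mp (W.sub_mem hone' hk)
      ext x
      cases hx : t (e (x + k)) <;> simp [hx]
    · refine (congrArg (· ∈ W) ?_).mp hk
      ext x
      cases t (e (x + k)) <;> simp
  clear_value W
  refine ⟨0, containsStar_of_single_mem 0 fun i => ?_⟩
  rcases h with h | h <;> simp only [h] at hW'
  · refine (congrArg (· ∈ W) ?_).mp (hW' (-i))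
    ext x
    cases b <;> revert x i <;> decide
  · refine (congrArg (· ∈ W) ?_).mp
      (W.sub_mem hone' (W.add_mem (hW' (-(i + 1))) (hW' (-(i + 3)))))
    ext x
    cases b <;> revert x i <;> decide

theorem sign_vector_mem_imageLattice {g : ℕ} {G : Subgroup (Equiv.Perm (Fin g × Bool))}
    (hsigned : ∀ σ ∈ G, ∀ p : Fin g × Bool, σ (p.1, !p.2) = ((σ p).1, !(σ p).2))
    {σ : Equiv.Perm (Fin g × Bool)} (hσ : σ ∈ G) :
    (fun i => if (σ (i, true)).2 then 0 else 1) ∈ imageLattice g G := by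
  refine AddSubgroup.subset_closure ⟨σ⁻¹, G.inv_mem hσ, ?_⟩
  ext i
  have hi : σ (i, false) = ((σ (i, true)).1, !(σ (i, true)).2) := hsigned σ hσ (i, true)
  have : (∃ j, σ⁻¹ (j, true) = (i, false)) ↔ (σ (i, true)).2 = false := by
    simp only [Equiv.Perm.inv_eq_iff_eq, hi, Prod.ext_iff]
    cases (σ (i, true)).2 <;> simp
  simp only [this]
  cases (σ (i, true)).2 <;> simp

theorem exists_orderOf_eq_five {G : Subgroup (Equiv.Perm (Fin 5 × Bool))}
    (htrans : ∀ p q : Fin 5 × Bool, ∃ σ ∈ G, σ p = q) : ∃ ρ ∈ G, orderOf ρ = 5 := by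
  have : MulAction.IsPretransitive G (Fin 5 × Bool) := ⟨fun p q => by
    obtain ⟨σ, hσ, h⟩ := htrans p q
    exact ⟨⟨σ, hσ⟩, h⟩⟩
  have hdvd : 5 ∣ Nat.card G := by
    have h1 := MulAction.index_stabilizer_of_transitive G ((0 : Fin 5), true)
    have h2 := (MulAction.stabilizer G ((0 : Fin 5), true)).index_dvd_card
    rw [h1] at h2
    exact dvd_trans (by simp) h2
  have : Fact (Nat.Prime 5) := ⟨by norm_num⟩
  obtain ⟨ρ, hρ⟩ := exists_prime_orderOf_dvd_card' 5 hdvd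
  exact ⟨ρ, ρ.2, (Subgroup.orderOf_coe ρ).trans hρ⟩

/-- An element of order five of a signed permutation group of degree five has an orbit that meets
every `{(i, true), (i, false)}` exactly once. -/
theorem exists_orbit_labelling {ρ : Equiv.Perm (Fin 5 × Bool)} (hρ : orderOf ρ = 5)
    (hsigned : ∀ n : ℕ, ∀ p : Fin 5 × Bool,
      (ρ ^ n) (p.1, !p.2) = (((ρ ^ n) p).1, !((ρ ^ n) p).2)) :
    ∃ (e : ZMod 5 ≃ Fin 5) (t : ZMod 5 → Bool),
      ∀ j k : ZMod 5, (ρ ^ k.val) (e j, t j) = (e (j + k), t (j + k)) := by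
  obtain ⟨p₀, hp₀⟩ : ∃ p, ρ p ≠ p := by
    by_contra! h
    have : ρ = 1 := Equiv.ext h
    simp [this] at hρ
  let p : ZMod 5 → Fin 5 × Bool := fun k => (ρ ^ k.val) p₀
  have hp : ∀ j k, (ρ ^ k.val) (p j) = p (j + k) := fun j k => by
    change (ρ ^ k.val * ρ ^ j.val) p₀ = (ρ ^ (j + k).val) p₀
    have hmod := pow_mod_orderOf ρ (j.val + k.val)
    rw [hρ] at hmod
    rw [← pow_add, ZMod.val_add, hmod, add_comm]
  have hfix : ∀ j d, p (j + d) = p j → d = 0 := fun j d h => by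
    by_contra hd
    have hshift : ∀ i, p (i + d) = p i := fun i => by
      have := congrArg (ρ ^ (i - j).val) h
      rw [hp, hp] at this
      convert this using 2 <;> ring
    have hmul : ∀ n : ℕ, p (n * d) = p 0 := fun n => by
      induction n with
      | zero => simp
      | succ n ih => rw [← ih, ← hshift (n * d)]; congr 1; push_cast; ring
    have h1 := hmul (d⁻¹).val
    have : Fact (Nat.Prime 5) := ⟨by norm_num⟩
    rw [ZMod.natCast_zmod_val, inv_mul_cancel₀ hd] at h1
    exact hp₀ (by simpa [p, show (1 : ZMod 5).val = 1 from rfl] using h1)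
  have hinj : Function.Injective fun k => (p k).1 := fun j k hjk => by
    replace hjk : (p j).1 = (p k).1 := hjk
    have hk := hp j (k - j)
    rw [add_sub_cancel] at hk
    by_cases hs : (p j).2 = (p k).2
    · have := hfix j (k - j) (by rw [add_sub_cancel]; exact (Prod.ext hjk hs).symm)
      exact (sub_eq_zero.mp this).symm
    · have hflip : p k = ((p j).1, !(p j).2) := by
        refine Prod.ext hjk.symm ?_
        cases h1 : (p j).2 <;> cases h2 : (p k).2 <;> simp_all
      have h2 := hp k (k - j)
      nth_rewrite 1 [hflip] at h2
      rw [hsigned, hk, hflip] at h2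
      have := hfix j (2 * (k - j)) (by
        rw [show j + 2 * (k - j) = k + (k - j) by ring, ← h2]
        simp)
      have h0 : k - j = 0 := by
        generalize k - j = d at this
        revert d
        decide
      exact (sub_eq_zero.mp h0).symm
  have hbij : Function.Bijective fun k => (p k).1 :=
    (Fintype.bijective_iff_injective_and_card _).mpr ⟨hinj, by simp⟩
  exact ⟨Equiv.ofBijective _ hbij, fun k => (p k).2, fun j k => hp j k⟩

/-- The dichotomy in the proof of Lemma 7.12: in the signed-permutation setup with
`g = 5`, the quotient `ℤ⁵/U` is either torsion-free or isomorphic to `ℤ/3ℤ`. -/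
theorem imageLattice_five_dichotomy
    (G : Subgroup (Equiv.Perm (Fin 5 × Bool)))
    (hsigned : ∀ σ ∈ G, ∀ p : Fin 5 × Bool, σ (p.1, !p.2) = ((σ p).1, !(σ p).2))
    (hδ : signFlip 5 ∈ G)
    (htrans : ∀ p q : Fin 5 × Bool, ∃ σ ∈ G, σ p = q)
    (hprim : ∀ τ ∈ G,
      (fun σ => σ * τ) '' {σ | σ ∈ G ∧ (σ ((0 : Fin 5), true)).2 = true}
          = {σ | σ ∈ G ∧ (σ ((0 : Fin 5), true)).2 = true} →
      τ ((0 : Fin 5), true) = ((0 : Fin 5), true)) :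
    IsAddTorsionFree ((Fin 5 → ℤ) ⧸ imageLattice 5 G) ∨
      Nonempty (((Fin 5 → ℤ) ⧸ imageLattice 5 G) ≃+ ZMod 3) := by
  obtain ⟨ρ, hρG, hρ⟩ := exists_orderOf_eq_five htrans
  obtain ⟨e, t, het⟩ := exists_orbit_labelling hρ fun n => hsigned _ (G.pow_mem hρG n)
  set U := imageLattice 5 G
  have hmem : ∀ σ ∈ G, (fun i => if (σ (i, true)).2 then (0 : ℤ) else 1) ∈ U :=
    fun σ hσ => sign_vector_mem_imageLattice hsigned hσ
  suffices ∃ a, ContainsStar (U.comap (reindexHom e)) a by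
    obtain ⟨a, ha⟩ := this
    exact (ContainsStar.of_comap e ha).quotient
  have hone : 1 ∈ U.comap (reindexHom e) := by
    refine (congrArg (· ∈ U) ?_).mp (hmem _ hδ)
    ext i
    simp [signFlip, reindexHom]
  by_cases ht : ∃ i j, t i ≠ t j
  · refine exists_containsStar_of_coboundary hone t ht fun k => ?_
    refine (congrArg (· ∈ U) ?_).mp (hmem _ (G.pow_mem hρG k.val))
    ext i
    obtain ⟨j, rfl⟩ := e.surjective i
    have h1 := het j k
    have h2 := hsigned _ (G.pow_mem hρG k.val) (e j, t j)
    rw [h1] at h2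
    simp only [reindexHom, AddMonoidHom.coe_mk, ZeroHom.coe_mk, Function.comp_apply,
      Equiv.symm_apply_apply]
    cases hj : t j <;> cases hk : t (j + k) <;> rw [hj, hk] at h1 h2 <;>
      simp only [Bool.not_true, Bool.not_false] at h2 <;> simp [h1, h2]
  · push Not at ht
    have hρ' : ∀ j k, (ρ ^ k.val) (e j, true) = (e (j + k), true) := fun j k => by
      have h1 := het j k
      have h2 := hsigned _ (G.pow_mem hρG k.val) (e j, t j)
      rw [h1, ht (j + k) j] at h2
      rw [ht (j + k) j] at h1
      cases hj : t j <;> rw [hj] at h1 h2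
      · exact h2
      · exact h1
    obtain ⟨σ, hσ, hne⟩ : ∃ σ ∈ G, (σ (1, true)).2 ≠ (σ (0, true)).2 := by
      by_contra! hcon
      obtain ⟨τ, hτ, hτ1⟩ := htrans (0, true) (1, true)
      have := hprim τ hτ (by
        ext σ
        simp only [Set.mem_image, Set.mem_ofPred_eq]
        constructor
        · rintro ⟨σ, ⟨hσ, h⟩, rfl⟩
          exact ⟨G.mul_mem hσ hτ, by rw [Equiv.Perm.mul_apply, hτ1, hcon σ hσ, h]⟩
        · rintro ⟨hσ, h⟩
          have hστ := G.mul_mem hσ (G.inv_mem hτ)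
          refine ⟨σ * τ⁻¹, ⟨hστ, ?_⟩, by simp⟩
          rw [← hcon _ hστ, ← hτ1]
          simpa using h)
      rw [hτ1] at this
      simp at this
    refine exists_containsStar_of_translates hone (fun j => (σ (e j, true)).2)
      ⟨e.symm 1, e.symm 0, by simpa using hne⟩ fun k => ?_
    refine (congrArg (· ∈ U) ?_).mp (hmem _ (G.mul_mem hσ (G.pow_mem hρG k.val)))
    ext i
    obtain ⟨j, rfl⟩ := e.surjective i
    simp [reindexHom, hρ']
end
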